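/- Let (Γ_n) be a sequence of finite connected vertex-transitive graphs of diverging sizes n with uniformly bounded degree satisfying D² = o(n/log n). Fix k ≥ 1 and s ∈ ℝ, and let t_s = E_π(T_o)(log n + s). Then uniformly over all sets A of vertices with |A| = k, P_π(T_A > t_s) = exp(−(E_π(T_o)/E_π(T_A))·(log n + s))·(1 + o(1)) as n → ∞. -/

import Mathlib

open MeasureTheory Filter

noncomputable section

/-- Heat kernel (transition semigroup) of the continuous-time rate-1 Markov chain with
one-step transition matrix `K`, given by the uniformization formula
`p_t = e^{-t} ∑_k (t^k/k!) K^k`. -/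
def heatKer {V : Type} [Fintype V] [DecidableEq V] (K : Matrix V V ℝ) (t : ℝ) (x y : V) : ℝ :=
  ∑' k : ℕ, Real.exp (-t) * t ^ k / (Nat.factorial k : ℝ) * (K ^ k) x y

/-- A continuous-time Markov chain with jump matrix `K`: a family of path measures `P x`
(for the chain started at `x`), with right-continuous paths, whose finite-dimensional
distributions are given by the heat kernel of `K`. -/
structure CTMC (V : Type) [Fintype V] [DecidableEq V] (K : Matrix V V ℝ) where
  Ω : Type
  mΩ : MeasurableSpace Ω
  P : V → @Measure Ω mΩ
  prob : ∀ x, IsProbabilityMeasure (P x)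
  X : ℝ → Ω → V
  measX : ∀ (t : ℝ) (y : V), MeasurableSet[mΩ] {ω | X t ω = y}
  rightCts : ∀ (ω : Ω) (t : ℝ), ∃ ε > 0, ∀ s, t ≤ s → s < t + ε → X s ω = X t ω
  fdd : ∀ (x : V) (n : ℕ) (t : Fin (n + 1) → ℝ), Monotone t → t 0 = 0 →
    ∀ y : Fin (n + 1) → V,
      P x {ω | ∀ i, X (t i) ω = y i} =
        ENNReal.ofReal ((if y 0 = x then (1 : ℝ) else 0) *
          ∏ i : Fin n, heatKer K (t i.succ - t i.castSucc) (y i.castSucc) (y i.succ))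

namespace CTMC

variable {V : Type} [Fintype V] [DecidableEq V] {K : Matrix V V ℝ}

/-- Hitting time of a set of states. -/
def hit (W : CTMC V K) (A : Set V) (ω : W.Ω) : ℝ :=
  sInf {t : ℝ | 0 ≤ t ∧ W.X t ω ∈ A}

/-- Cover time: the first time every state has been visited. -/
def cov (W : CTMC V K) (ω : W.Ω) : ℝ :=
  sInf {t : ℝ | 0 ≤ t ∧ ∀ y : V, ∃ s, 0 ≤ s ∧ s ≤ t ∧ W.X s ω = y}

/-- The uncovered set at time `t`. -/
def uncov (W : CTMC V K) (t : ℝ) (ω : W.Ω) : Set V :=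
  {y | ∀ s, 0 ≤ s → s ≤ t → W.X s ω ≠ y}

/-- Local time at `y` up to time `t`. -/
def loc (W : CTMC V K) (y : V) (t : ℝ) (ω : W.Ω) : ℝ :=
  ∫ s in (0:ℝ)..t, (if W.X s ω = y then (1 : ℝ) else 0)

/-- Probability of an event for the walk started at `x`. -/
def prx (W : CTMC V K) (x : V) (S : Set W.Ω) : ℝ := (W.P x S).toReal

/-- Expectation of a path functional for the walk started at `x`. -/
def ex (W : CTMC V K) (x : V) (f : W.Ω → ℝ) : ℝ := ∫ ω, f ω ∂(W.P x)

/-- Probability of an event for the walk started from the uniform (stationary) distribution. -/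
def prpi (W : CTMC V K) (S : Set W.Ω) : ℝ :=
  (Fintype.card V : ℝ)⁻¹ * ∑ x : V, W.prx x S

/-- Expectation for the walk started from the uniform (stationary) distribution. -/
def epi (W : CTMC V K) (f : W.Ω → ℝ) : ℝ :=
  (Fintype.card V : ℝ)⁻¹ * ∑ x : V, W.ex x f

/-- Probability for the walk started from the initial distribution `a`. -/
def prw (W : CTMC V K) (a : V → ℝ) (S : Set W.Ω) : ℝ := ∑ x : V, a x * W.prx x S

/-- Expectation for the walk started from the initial distribution `a`. -/
def exw (W : CTMC V K) (a : V → ℝ) (f : W.Ω → ℝ) : ℝ := ∑ x : V, a x * W.ex x f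

end CTMC

/-- Total variation mixing time at level `1/4`. -/
def tmixTV {V : Type} [Fintype V] [DecidableEq V] (K : Matrix V V ℝ) : ℝ :=
  sInf {t : ℝ | 0 ≤ t ∧ ∀ x : V, ∑ y : V, |heatKer K t x y - (Fintype.card V : ℝ)⁻¹| ≤ 1 / 2}

/-- Transition matrix of the simple random walk on a graph. -/
def transMat {V : Type} [Fintype V] [DecidableEq V] (G : SimpleGraph V) [DecidableRel G.Adj] :
    Matrix V V ℝ :=
  Matrix.of fun x y => if G.Adj x y then ((G.degree x : ℝ))⁻¹ else 0

/-- Diameter of a finite graph. -/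
def gDiam {V : Type} [Fintype V] (G : SimpleGraph V) : ℕ :=
  Finset.univ.sup fun p : V × V => G.dist p.1 p.2

/-- Vertex-transitivity of a graph. -/
def IsVertexTransitive {V : Type} (G : SimpleGraph V) : Prop :=
  ∀ x y : V, ∃ φ : SimpleGraph.Iso G G, φ x = y

/-- A finite graph bundled together with a continuous-time rate-1 simple random walk on it. -/
structure GW where
  (V : Type) [fin : Fintype V] [deq : DecidableEq V]
  (G : SimpleGraph V) [adj : DecidableRel G.Adj]
  (W : CTMC V (transMat G))

instance (B : GW) : Fintype B.V := B.fin
instance (B : GW) : DecidableEq B.V := B.deq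
instance (B : GW) : DecidableRel B.G.Adj := B.adj
instance (B : GW) : MeasurableSpace B.W.Ω := B.W.mΩ

/-- Number of vertices. -/
def GW.nV (B : GW) : ℕ := Fintype.card B.V

/-- Diameter. -/
def GW.D (B : GW) : ℕ := gDiam B.G

/-- `f(n)`, defined by `n = D² f(n)`. -/
def GW.fgrowth (B : GW) : ℝ := (B.nV : ℝ) / (B.D : ℝ) ^ 2

/-- Standing assumptions: a sequence of finite connected vertex-transitive graphs with
degrees uniformly bounded by `d`, of diverging sizes, satisfying the diameter condition
`D² = o(n / log n)`. -/
def GoodSeq (B : ℕ → GW) (d : ℕ) : Prop :=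
  (∀ n, (B n).G.Connected) ∧
  (∀ n, IsVertexTransitive (B n).G) ∧
  (∀ n (x : (B n).V), (B n).G.degree x ≤ d) ∧
  Tendsto (fun n => (B n).nV) atTop atTop ∧
  Tendsto (fun n => ((B n).D : ℝ) ^ 2 * Real.log ((B n).nV) / ((B n).nV)) atTop (nhds 0)

/-- The transition matrix of the chain killed upon hitting `A`. -/
def killedMat {V : Type} [Fintype V] [DecidableEq V] (K : Matrix V V ℝ) (A : Finset V) :
    Matrix V V ℝ :=
  Matrix.of fun x y => if x ∈ A ∨ y ∈ A then 0 else K x y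

/-- `a` is the quasi-stationary distribution of `A` with rate `lam`: a probability
distribution supported off `A` which is a left eigenvector of the killed matrix for the
eigenvalue `1 - lam`, where `lam` is the smallest eigenvalue of `I_B - P_B`. -/
structure IsQSD {V : Type} [Fintype V] [DecidableEq V] (K : Matrix V V ℝ) (A : Finset V)
    (a : V → ℝ) (lam : ℝ) : Prop where
  nonneg : ∀ x, 0 ≤ a x
  sum_one : ∑ x : V, a x = 1
  supported : ∀ v ∈ A, a v = 0
  eigen : ∀ y : V, ∑ x : V, a x * killedMat K A x y = (1 - lam) * a y
  minimal : ∀ (mu : ℝ) (g : V → ℝ), g ≠ 0 → (∀ v ∈ A, g v = 0) →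
    (∀ y : V, ∑ x : V, g x * killedMat K A x y = (1 - mu) * g y) → lam ≤ mu

/-- Spectral gap `1 - λ₂` of a reversible transition matrix `K` with stationary
distribution `pd`. -/
def specGap {V : Type} [Fintype V] (K : Matrix V V ℝ) (pd : V → ℝ) : ℝ :=
  sInf {r : ℝ | ∃ g : V → ℝ, g ≠ 0 ∧ (∑ x : V, pd x * g x = 0) ∧
    ∀ y : V, ∑ x : V, K y x * g x = (1 - r) * g y}

/-- Relaxation time of a reversible chain. -/
def trel {V : Type} [Fintype V] (K : Matrix V V ℝ) (pd : V → ℝ) : ℝ := (specGap K pd)⁻¹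

/-- Total variation distance between two Borel measures on `ℝ`. -/
def dTVReal (μ ν : Measure ℝ) : ℝ :=
  ⨆ A : {A : Set ℝ // MeasurableSet A}, |(μ A.1).toReal - (ν A.1).toReal|

/-- The standard Gumbel distribution on `ℝ` (distribution function `s ↦ exp (-e^{-s})`). -/
def gumbelMeasure : Measure ℝ :=
  volume.withDensity fun s => ENNReal.ofReal (Real.exp (-s - Real.exp (-s)))

/-- `ψ(u) = (2/π²) ∑_{k ≥ 1} cos(2πku)/k²`. -/
def psiSeries (u : ℝ) : ℝ :=
  (2 / Real.pi ^ 2) * ∑' k : ℕ, Real.cos (2 * Real.pi * ((k : ℝ) + 1) * u) / ((k : ℝ) + 1) ^ 2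

/-- The cycle graph on `ℤ/mℤ`. -/
def cycleG (m : ℕ) : SimpleGraph (ZMod m) := SimpleGraph.fromRel fun x y => x - y = 1

instance (m : ℕ) : DecidableRel (cycleG m).Adj := fun _ _ => Classical.dec _

section Spectral

open Matrix

variable {V : Type} [Fintype V] [DecidableEq V]

open scoped Matrix.Norms.Operator in
lemma exp_mulVec_of_eigenvector (M : Matrix V V ℝ) (v : V → ℝ) (μ : ℝ) (h : M *ᵥ v = μ • v) :
    NormedSpace.exp M *ᵥ v = Real.exp μ • v := by
  have hpow : ∀ j : ℕ, (M ^ j) *ᵥ v = μ ^ j • v := by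
    intro j
    induction j with
    | zero => simp
    | succ j ih =>
      rw [pow_succ, ← Matrix.mulVec_mulVec, h, Matrix.mulVec_smul, ih, smul_smul, pow_succ, mul_comm]
  have h1 := NormedSpace.exp_series_hasSum_exp' (𝕂 := ℝ) M
  have h2 := NormedSpace.exp_series_hasSum_exp' (𝕂 := ℝ) μ
  rw [← Real.exp_eq_exp_ℝ] at h2
  let L : Matrix V V ℝ →+ (V → ℝ) :=
    { toFun := fun N => N *ᵥ v
      map_zero' := by simp
      map_add' := fun a b => Matrix.add_mulVec a b v }
  have hL : Continuous L := by
    change Continuous fun N : Matrix V V ℝ => N *ᵥ v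
    fun_prop
  have h3 := h1.map L hL
  have h4 := h2.smul_const v
  refine h3.unique ?_
  convert h4 using 1
  funext j
  simp only [L, Function.comp, AddMonoidHom.coe_mk, ZeroHom.coe_mk, Matrix.smul_mulVec, hpow,
    smul_smul, smul_eq_mul]

lemma exists_eigenvector_expansion (H : Matrix V V ℝ) (hH : ∀ x y, H x y = H y x) :
    ∃ (μ : V → ℝ) (v : V → V → ℝ), (∀ i, H *ᵥ v i = μ i • v i) ∧ (∀ i, v i ⬝ᵥ v i = 1) ∧
      ∀ f : V → ℝ, f = ∑ i, (v i ⬝ᵥ f) • v i := by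
  have hh : H.IsHermitian := by
    ext x y
    simp [hH x y]
  refine ⟨hh.eigenvalues, fun i => (hh.eigenvectorBasis i).ofLp, fun i => ?_, fun i => ?_,
    fun f => ?_⟩
  · simpa using hh.mulVec_eigenvectorBasis i
  · have h := hh.eigenvectorBasis.orthonormal.1 i
    have h2 : inner ℝ (hh.eigenvectorBasis i) (hh.eigenvectorBasis i) = 1 := by
      rw [real_inner_self_eq_norm_sq, h]; norm_num
    rw [EuclideanSpace.inner_eq_star_dotProduct] at h2
    simpa using h2
  · have h := hh.eigenvectorBasis.sum_repr (WithLp.toLp 2 f)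
    have h2 := congrArg WithLp.ofLp h
    rw [WithLp.ofLp_sum] at h2
    rw [← show (WithLp.toLp 2 f).ofLp = f from rfl, ← h2]
    refine Finset.sum_congr rfl fun i _ => ?_
    rw [WithLp.ofLp_smul, h2, OrthonormalBasis.repr_apply_apply,
      EuclideanSpace.inner_eq_star_dotProduct]
    simp [dotProduct_comm]

end Spectral

/-- A symmetric stochastic matrix satisfying a Poincaré inequality with constant `R`. -/
structure IsPoincareKernel {V : Type} [Fintype V] (K : Matrix V V ℝ) (R : ℝ) : Prop where
  symm : ∀ x y, K x y = K y x
  nonneg : ∀ x y, 0 ≤ K x y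
  sum_one : ∀ x, ∑ y, K x y = 1
  one_le : 1 ≤ R
  poincare : ∀ f : V → ℝ, ∑ x, f x ^ 2 - (∑ x, f x) ^ 2 / (Fintype.card V : ℝ) ≤
    R * ∑ x, f x * (f x - ∑ y, K x y * f y)

/-- The indicator of the complement of `A`, as a real function. -/
def offInd {V : Type} [DecidableEq V] (A : Finset V) (x : V) : ℝ := if x ∈ A then 0 else 1

/-- The tail of the hitting time of `A` from the uniform distribution, expressed through the
semigroup of the killed chain. -/
def killedTail {V : Type} [Fintype V] [DecidableEq V] (K : Matrix V V ℝ) (A : Finset V) (t : ℝ) :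
    ℝ :=
  (Fintype.card V : ℝ)⁻¹ *
    (offInd A ⬝ᵥ (NormedSpace.exp (t • (killedMat K A - 1))).mulVec (offInd A))

section Killed

open Matrix

variable {V : Type} [Fintype V] [DecidableEq V] {K : Matrix V V ℝ} {R : ℝ}

lemma killedMat_mulVec_of_mem (A : Finset V) (f : V → ℝ) {x : V} (hx : x ∈ A) :
    (killedMat K A *ᵥ f) x = 0 := by
  simp [Matrix.mulVec, dotProduct, killedMat, hx]

lemma killedMat_mulVec_of_vanish (A : Finset V) (f : V → ℝ) (hf : ∀ y ∈ A, f y = 0) {x : V}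
    (hx : x ∉ A) : (killedMat K A *ᵥ f) x = ∑ y, K x y * f y := by
  simp only [Matrix.mulVec, dotProduct, killedMat, Matrix.of_apply]
  refine Finset.sum_congr rfl fun y _ => ?_
  by_cases hy : y ∈ A
  · simp [hy, hf y hy]
  · simp [hx, hy]

lemma sum_offInd [Nonempty V] (A : Finset V) :
    ∑ x, offInd A x = (Fintype.card V : ℝ) - A.card := by
  have : ∀ x, offInd A x = 1 - (if x ∈ A then 1 else 0 : ℝ) := by
    intro x; by_cases hx : x ∈ A <;> simp [offInd, hx]
  simp [this, Finset.sum_sub_distrib]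

lemma IsPoincareKernel.exists_tail_expansion [Nonempty V] (hK : IsPoincareKernel K R)
    (A : Finset V) (hA : A.Nonempty) :
    ∃ (c l : V → ℝ), (∀ i, 0 ≤ c i) ∧ (∀ i, 0 < l i) ∧ (∀ i, 1 - R * l i ≤ c i) ∧
      ∑ i, c i = 1 - A.card / (Fintype.card V : ℝ) ∧
      ∑ i, c i * l i ≤ A.card / (Fintype.card V : ℝ) ∧
      ∀ t, killedTail K A t = ∑ i, c i * Real.exp (-(l i * t)) := by
  have hn : (0 : ℝ) < Fintype.card V := by exact_mod_cast Fintype.card_pos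
  obtain ⟨μ, v, hμ, hv, hexp⟩ := exists_eigenvector_expansion (killedMat K A)
    (fun x y => by simp [killedMat, hK.symm x y, or_comm])
  set w := offInd A with hw
  have hform : ∀ (N : Matrix V V ℝ) (ν : V → ℝ), (∀ i, N *ᵥ v i = ν i • v i) →
      w ⬝ᵥ N *ᵥ w = ∑ i, (v i ⬝ᵥ w) ^ 2 * ν i := by
    intro N ν hN
    conv_lhs => rw [show N *ᵥ w = N *ᵥ ∑ i, (v i ⬝ᵥ w) • v i by rw [← hexp w]]
    simp only [Matrix.mulVec_sum, Matrix.mulVec_smul, hN, dotProduct_sum, dotProduct_smul,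
      smul_eq_mul]
    exact Finset.sum_congr rfl fun i _ => by rw [dotProduct_comm w]; ring
  have hww : w ⬝ᵥ w = (Fintype.card V : ℝ) - A.card := by
    rw [← sum_offInd]
    refine Finset.sum_congr rfl fun x _ => ?_
    by_cases hx : x ∈ A <;> simp [hw, offInd, hx]
  have hdich : ∀ i, μ i = 0 ∨ ∀ x ∈ A, v i x = 0 := by
    intro i
    by_cases h0 : μ i = 0
    · exact Or.inl h0
    · refine Or.inr fun x hx => ?_
      have h := congrFun (hμ i) x
      rw [killedMat_mulVec_of_mem A _ hx] at h
      simpa [h0] using h.symm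
  have hpoin : ∀ i, (∀ x ∈ A, v i x = 0) →
      1 - (v i ⬝ᵥ w) ^ 2 / (Fintype.card V : ℝ) ≤ R * (1 - μ i) := by
    intro i hi
    have h1 : ∑ x, v i x ^ 2 = 1 := by
      rw [← hv i]; exact Finset.sum_congr rfl fun x _ => by ring
    have h2 : ∑ x, v i x = v i ⬝ᵥ w := by
      refine Finset.sum_congr rfl fun x _ => ?_
      by_cases hx : x ∈ A
      · simp [hi x hx]
      · simp [hw, offInd, hx]
    have h3 : ∑ x, v i x * (v i x - ∑ y, K x y * v i y) = 1 - μ i := by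
      have : ∀ x, v i x * (v i x - ∑ y, K x y * v i y) = (1 - μ i) * v i x ^ 2 := by
        intro x
        by_cases hx : x ∈ A
        · simp [hi x hx]
        · rw [← killedMat_mulVec_of_vanish A (v i) hi hx, hμ i]
          simp; ring
      rw [Finset.sum_congr rfl fun x _ => this x, ← Finset.mul_sum, h1, mul_one]
    have h := hK.poincare (v i)
    rwa [h1, h2, h3] at h
  have hR : 0 < R := lt_of_lt_of_le one_pos hK.one_le
  refine ⟨fun i => (v i ⬝ᵥ w) ^ 2 / (Fintype.card V : ℝ), fun i => 1 - μ i,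
    fun i => by positivity, fun i => ?_, fun i => ?_, ?_, ?_, fun t => ?_⟩
  · rcases hdich i with h | h
    · simp [h]
    · have hCS : (v i ⬝ᵥ w) ^ 2 ≤ (∑ x, v i x ^ 2) * ∑ x, w x ^ 2 :=
        Finset.sum_mul_sq_le_sq_mul_sq _ _ _
      have e1 : ∑ x, v i x ^ 2 = 1 := by
        rw [← hv i]; exact Finset.sum_congr rfl fun x _ => by ring
      have e2 : ∑ x, w x ^ 2 = (Fintype.card V : ℝ) - A.card := by
        rw [← hww]; exact Finset.sum_congr rfl fun x _ => by ring
      rw [e1, e2, one_mul] at hCS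
      have hA' : (0 : ℝ) < A.card := by exact_mod_cast hA.card_pos
      have h5 : (v i ⬝ᵥ w) ^ 2 / (Fintype.card V : ℝ) < 1 := by
        rw [div_lt_one hn]; linarith
      have h6 := hpoin i h
      have h7 : 0 < R * (1 - μ i) := by linarith
      exact (pos_iff_pos_of_mul_pos h7).1 hR
  · rcases hdich i with h | h
    · have := hK.one_le
      have h8 : 0 ≤ (v i ⬝ᵥ w) ^ 2 / (Fintype.card V : ℝ) := by positivity
      simp only [h]
      linarith
    · linarith [hpoin i h]
  · have h := hform 1 (fun _ => 1) (fun i => by simp)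
    rw [Matrix.one_mulVec, hww] at h
    rw [← Finset.sum_div, ← Finset.sum_congr rfl fun i _ => mul_one ((v i ⬝ᵥ w) ^ 2), ← h]
    field_simp
  · have h := hform (1 - killedMat K A) (fun i => 1 - μ i)
      (fun i => by rw [Matrix.sub_mulVec, hμ i, sub_smul]; simp)
    have e : ∀ i, (v i ⬝ᵥ w) ^ 2 / (Fintype.card V : ℝ) * (1 - μ i) =
        (v i ⬝ᵥ w) ^ 2 * (1 - μ i) / (Fintype.card V : ℝ) := fun i => by ring
    rw [Finset.sum_congr rfl fun i _ => e i, ← Finset.sum_div, ← h]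
    gcongr
    have e2 : w ⬝ᵥ (1 - killedMat K A) *ᵥ w = ∑ x, w x * (1 - ∑ y, K x y * w y) := by
      refine Finset.sum_congr rfl fun x _ => ?_
      by_cases hx : x ∈ A
      · simp [hw, offInd, hx]
      · rw [Matrix.sub_mulVec, Pi.sub_apply, killedMat_mulVec_of_vanish A w
          (fun y hy => by simp [hw, offInd, hy]) hx]
        simp [hw, offInd, hx]
    have e3 : ∀ x, 1 - ∑ y, K x y * w y = ∑ y ∈ A, K x y := by
      intro x
      rw [← hK.sum_one x, ← Finset.sum_sub_distrib, ← Finset.sum_filter_add_sum_filter_not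
        Finset.univ (fun y => y ∈ A)]
      have z : ∑ y with y ∉ A, (K x y - K x y * w y) = 0 := by
        refine Finset.sum_eq_zero fun y hy => ?_
        have : y ∉ A := by simpa using hy
        simp [hw, offInd, this]
      rw [z, add_zero]
      have : Finset.univ.filter (fun y => y ∈ A) = A := by ext; simp
      rw [this]
      refine Finset.sum_congr rfl fun y hy => ?_
      simp [hw, offInd, hy]
    rw [e2]
    calc ∑ x, w x * (1 - ∑ y, K x y * w y) ≤ ∑ x, ∑ y ∈ A, K x y := by
          refine Finset.sum_le_sum fun x _ => ?_
          rw [e3 x]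
          have : 0 ≤ ∑ y ∈ A, K x y := Finset.sum_nonneg fun y _ => hK.nonneg x y
          by_cases hx : x ∈ A
          · simpa [hw, offInd, hx] using this
          · simp [hw, offInd, hx]
      _ = ∑ y ∈ A, ∑ x, K y x := by
          refine (Finset.sum_comm (f := fun x y => K x y)).trans ?_
          exact Finset.sum_congr rfl fun y _ => Finset.sum_congr rfl fun x _ => hK.symm _ _
      _ = A.card := by simp [hK.sum_one]
  · rw [killedTail, ← hw, hform _ (fun i => Real.exp (-((1 - μ i) * t))) (fun i => ?_),
      Finset.mul_sum]
    · exact Finset.sum_congr rfl fun i _ => by ring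
    · refine exp_mulVec_of_eigenvector _ _ _ ?_
      rw [Matrix.smul_mulVec, Matrix.sub_mulVec, hμ i, Matrix.one_mulVec]
      ext x
      simp
      ring

end Killed

section Tail

variable {V : Type} [Fintype V] [DecidableEq V] {K : Matrix V V ℝ} {R : ℝ}

lemma IsPoincareKernel.exists_rate [Nonempty V] (hK : IsPoincareKernel K R)
    (A : Finset V) (hA : A.Nonempty) :
    ∃ l : ℝ, 0 < l ∧ IntegrableOn (killedTail K A) (Set.Ioi 0) ∧
      (∀ t, 0 ≤ t → (1 - R * l) * Real.exp (-(l * t)) ≤ killedTail K A t) ∧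
      (∀ t, 0 ≤ t → killedTail K A t ≤ Real.exp (-(l * t))) ∧
      l * ∫ t in Set.Ioi 0, killedTail K A t ≤ 1 ∧
      1 - R * l ≤ l * ∫ t in Set.Ioi 0, killedTail K A t ∧
      (1 - A.card / (Fintype.card V : ℝ)) ^ 2 ≤
        (∫ t in Set.Ioi 0, killedTail K A t) * (A.card / (Fintype.card V : ℝ)) := by
  obtain ⟨c, r, hc, hr, hcr, hsum, hsum', hF⟩ := hK.exists_tail_expansion A hA
  obtain ⟨j, -, hj⟩ := Finset.exists_min_image Finset.univ r Finset.univ_nonempty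
  have hj' : ∀ i, r j ≤ r i := fun i => hj i (Finset.mem_univ i)
  have hF' : killedTail K A = fun t => ∑ i, c i * Real.exp (-(r i * t)) := funext hF
  have hinteg : ∀ i, IntegrableOn (fun t => c i * Real.exp (-(r i * t))) (Set.Ioi 0) := by
    intro i
    have := (integrableOn_exp_mul_Ioi (neg_neg_of_pos (hr i)) 0).const_mul (c i)
    simp only [neg_mul] at this
    exact this
  have hM : ∫ t in Set.Ioi 0, killedTail K A t = ∑ i, c i / r i := by
    rw [hF', integral_finsetSum _ fun i _ => hinteg i]
    refine Finset.sum_congr rfl fun i _ => ?_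
    rw [integral_const_mul]
    have := integral_exp_mul_Ioi (neg_neg_of_pos (hr i)) 0
    simp only [neg_mul, mul_zero, Real.exp_zero] at this
    rw [this, neg_div_neg_eq, mul_one_div]
  have hle1 : ∑ i, c i ≤ 1 := by
    rw [hsum]
    have : 0 ≤ (A.card : ℝ) / (Fintype.card V : ℝ) := by positivity
    linarith
  refine ⟨r j, hr j, ?_, fun t ht => ?_, fun t ht => ?_, ?_, ?_, ?_⟩
  · rw [hF']
    exact integrable_finsetSum _ fun i _ => hinteg i
  · rw [hF]
    calc (1 - R * r j) * Real.exp (-(r j * t)) ≤ c j * Real.exp (-(r j * t)) := by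
          gcongr; exact hcr j
      _ ≤ _ := Finset.single_le_sum (f := fun i => c i * Real.exp (-(r i * t)))
          (fun i _ => mul_nonneg (hc i) (Real.exp_pos _).le) (Finset.mem_univ j)
  · rw [hF]
    calc ∑ i, c i * Real.exp (-(r i * t)) ≤ ∑ i, c i * Real.exp (-(r j * t)) := by
          refine Finset.sum_le_sum fun i _ => ?_
          have := hc i
          have := hj' i
          gcongr
      _ = (∑ i, c i) * Real.exp (-(r j * t)) := by rw [Finset.sum_mul]
      _ ≤ 1 * Real.exp (-(r j * t)) := by gcongr
      _ = _ := one_mul _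
  · rw [hM, Finset.mul_sum]
    refine le_trans (Finset.sum_le_sum fun i _ => ?_) hle1
    rw [mul_div_assoc', div_le_iff₀ (hr i), mul_comm]
    exact mul_le_mul_of_nonneg_left (hj' i) (hc i)
  · rw [hM]
    calc 1 - R * r j ≤ c j := hcr j
      _ = r j * (c j / r j) := by field_simp [(hr j).ne']
      _ ≤ _ := by
        refine mul_le_mul_of_nonneg_left ?_ (hr j).le
        exact Finset.single_le_sum (f := fun i => c i / r i)
          (fun i _ => div_nonneg (hc i) (hr i).le) (Finset.mem_univ j)
  · rw [hM, ← hsum]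
    have hnn : 0 ≤ ∑ i, c i / r i := Finset.sum_nonneg fun i _ => div_nonneg (hc i) (hr i).le
    refine le_trans (Finset.sum_sq_le_sum_mul_sum_of_sq_le_mul Finset.univ
      (f := fun i => c i / r i) (g := fun i => c i * r i)
      (fun i _ => div_nonneg (hc i) (hr i).le) (fun i _ => mul_nonneg (hc i) (hr i).le)
      fun i _ => le_of_eq ?_) (mul_le_mul_of_nonneg_left hsum' hnn)
    have := (hr i).ne'
    field_simp

lemma exp_reindexAlgEquiv (φ : V ≃ V) (M : Matrix V V ℝ) :
    NormedSpace.exp (Matrix.reindexAlgEquiv ℝ ℝ φ M) =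
      Matrix.reindexAlgEquiv ℝ ℝ φ (NormedSpace.exp M) := by
  have hcont : Continuous (Matrix.reindexAlgEquiv ℝ ℝ φ) := by
    change Continuous fun M : Matrix V V ℝ => Matrix.reindex φ φ M
    exact Continuous.matrix_reindex continuous_id φ φ
  open scoped Matrix.Norms.Operator in
  exact (NormedSpace.map_exp (Matrix.reindexAlgEquiv ℝ ℝ φ) hcont M).symm

lemma killedTail_map (φ : V ≃ V) (hφ : ∀ x y, K (φ x) (φ y) = K x y) (A : Finset V) (t : ℝ) :
    killedTail K (A.map φ.toEmbedding) t = killedTail K A t := by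
  have hind : ∀ x, offInd (A.map φ.toEmbedding) (φ x) = offInd A x := by
    intro x; simp [offInd]
  have hkill : Matrix.reindexAlgEquiv ℝ ℝ φ (t • (killedMat K A - 1)) =
      t • (killedMat K (A.map φ.toEmbedding) - 1) := by
    rw [map_smul, map_sub, map_one]
    congr 2
    ext x y
    obtain ⟨x, rfl⟩ := φ.surjective x
    obtain ⟨y, rfl⟩ := φ.surjective y
    simp [killedMat, hφ]
  rw [killedTail, killedTail, ← hkill, exp_reindexAlgEquiv]
  congr 1
  simp only [dotProduct, Matrix.mulVec]
  rw [← φ.sum_comp]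
  refine Finset.sum_congr rfl fun x _ => ?_
  rw [hind, ← φ.sum_comp]
  congr 1
  refine Finset.sum_congr rfl fun y _ => ?_
  rw [hind]
  simp

end Tail

section ProductFormula

variable {𝔸 : Type*} [NormedRing 𝔸]

lemma norm_pow_mul_le_of_norm_le (a x : 𝔸) {C : ℝ} (hC : 0 ≤ C) (ha : ‖a‖ ≤ C) (m : ℕ) :
    ‖a ^ m * x‖ ≤ C ^ m * ‖x‖ := by
  induction m with
  | zero => simp
  | succ m ih =>
    rw [pow_succ', mul_assoc, pow_succ', mul_assoc]
    exact (norm_mul_le _ _).trans (mul_le_mul ha ih (norm_nonneg _) hC)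

lemma norm_pow_sub_pow_le_of_norm_le (a b : 𝔸) {C : ℝ} (hC : 1 ≤ C) (ha : ‖a‖ ≤ C)
    (hb : ‖b‖ ≤ C) (m : ℕ) : ‖a ^ m - b ^ m‖ ≤ m * C ^ m * ‖a - b‖ := by
  have hC0 : 0 ≤ C := zero_le_one.trans hC
  induction m with
  | zero => simp
  | succ m ih =>
    have e : a ^ (m + 1) - b ^ (m + 1) = a ^ m * (a - b) + (a ^ m - b ^ m) * b := by
      rw [pow_succ, pow_succ]; noncomm_ring
    have h1 := norm_pow_mul_le_of_norm_le a (a - b) hC0 ha m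
    have h2 : ‖(a ^ m - b ^ m) * b‖ ≤ (m * C ^ m * ‖a - b‖) * C :=
      (norm_mul_le _ _).trans (mul_le_mul ih hb (norm_nonneg _) (by positivity))
    have h3 : C ^ m * ‖a - b‖ ≤ C ^ (m + 1) * ‖a - b‖ := by
      gcongr ?_ * _
      exact pow_le_pow_right₀ hC m.le_succ
    calc ‖a ^ (m + 1) - b ^ (m + 1)‖ ≤ C ^ m * ‖a - b‖ + (m * C ^ m * ‖a - b‖) * C := by
          rw [e]; exact (norm_add_le _ _).trans (add_le_add h1 h2)
      _ ≤ C ^ (m + 1) * ‖a - b‖ + (m * C ^ m * ‖a - b‖) * C := by gcongr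
      _ = _ := by push_cast; ring

lemma tendsto_pow_sub_pow_of_hasDerivAt [NormedAlgebra ℝ 𝔸] {S T : ℝ → 𝔸} {Z : 𝔸}
    (hS : HasDerivAt S Z 0) (hT : HasDerivAt T Z 0) (h0 : S 0 = T 0) (hn : ‖S 0‖ ≤ 1) (t : ℝ) :
    Tendsto (fun m : ℕ => S (t / m) ^ m - T (t / m) ^ m) atTop (nhds 0) := by
  have hlim : Tendsto (fun m : ℕ => t / (m : ℝ)) atTop (nhds 0) :=
    tendsto_const_div_atTop_nhds_zero_nat t
  have hO : ∀ U : ℝ → 𝔸, HasDerivAt U Z 0 → U 0 = S 0 →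
      ∃ c : ℝ, 0 < c ∧ ∀ᶠ h : ℝ in nhds 0, ‖U h‖ ≤ 1 + c * |h| := by
    intro U hU hU0
    have := hU.differentiableAt.isBigO_sub
    obtain ⟨c, hc, hb⟩ := this.exists_pos
    refine ⟨c, hc, ?_⟩
    filter_upwards [hb.bound] with h hh
    rw [sub_zero, Real.norm_eq_abs, hU0] at hh
    calc ‖U h‖ = ‖S 0 + (U h - S 0)‖ := by rw [add_sub_cancel]
      _ ≤ _ := (norm_add_le _ _).trans (add_le_add hn hh)
  obtain ⟨c₁, hc₁, h₁⟩ := hO S hS rfl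
  obtain ⟨c₂, hc₂, h₂⟩ := hO T hT h0.symm
  have ho : (fun h => S h - T h) =o[nhds 0] fun h : ℝ => h := by
    have := (hS.sub hT)
    rw [sub_self, hasDerivAt_iff_isLittleO] at this
    simpa [h0] using this
  rw [NormedAddGroup.tendsto_nhds_zero]
  intro ε hε
  set c := max c₁ c₂
  have hden : 0 < Real.exp (c * |t|) * (|t| + 1) := by positivity
  have hbd := ho.bound (div_pos hε hden)
  filter_upwards [hlim.eventually h₁, hlim.eventually h₂, hlim.eventually hbd,
    eventually_gt_atTop 0] with m e₁ e₂ e₃ hm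
  have hm' : (0 : ℝ) < m := by exact_mod_cast hm
  have hc : 0 < c := lt_max_of_lt_left hc₁
  have habs : |t / (m : ℝ)| = |t| / m := by rw [abs_div, abs_of_pos hm']
  have hCexp : (1 + c * |t / (m : ℝ)|) ^ m ≤ Real.exp (c * |t|) := by
    have : 1 + c * |t / (m : ℝ)| ≤ Real.exp (c * |t| / m) := by
      rw [habs, mul_div_assoc', add_comm]
      exact Real.add_one_le_exp _
    calc (1 + c * |t / (m : ℝ)|) ^ m ≤ Real.exp (c * |t| / m) ^ m := by gcongr
      _ = Real.exp (c * |t|) := by rw [← Real.exp_nat_mul]; congr 1; field_simp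
  have hC1 : 1 ≤ 1 + c * |t / (m : ℝ)| := by
    have : 0 ≤ c * |t / (m : ℝ)| := by positivity
    linarith
  have key := norm_pow_sub_pow_le_of_norm_le (S (t / m)) (T (t / m)) hC1
    (e₁.trans (by gcongr; exact le_max_left _ _)) (e₂.trans (by gcongr; exact le_max_right _ _)) m
  rw [Real.norm_eq_abs, habs] at e₃
  calc ‖S (t / m) ^ m - T (t / m) ^ m‖ ≤ m * (1 + c * |t / (m : ℝ)|) ^ m *
        ‖S (t / m) - T (t / m)‖ := key
    _ ≤ m * Real.exp (c * |t|) * (ε / (Real.exp (c * |t|) * (|t| + 1)) * (|t| / m)) := by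
        gcongr
    _ = ε * (|t| / (|t| + 1)) := by field_simp
    _ < ε * 1 := by
        gcongr
        rw [div_lt_one (by positivity)]
        linarith
    _ = ε := mul_one ε

end ProductFormula

section HeatKernel

variable {V : Type} [Fintype V] [DecidableEq V]

lemma heatKer_nonneg {K : Matrix V V ℝ} (hK : ∀ x y, 0 ≤ K x y) {t : ℝ} (ht : 0 ≤ t) (x y : V) :
    0 ≤ heatKer K t x y := by
  have hpow : ∀ (j : ℕ) x y, 0 ≤ (K ^ j) x y := by
    intro j
    induction j with
    | zero =>
      intro x y
      rw [pow_zero, Matrix.one_apply]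
      split_ifs <;> norm_num
    | succ j ih =>
      intro x y
      rw [pow_succ, Matrix.mul_apply]
      exact Finset.sum_nonneg fun z _ => mul_nonneg (ih x z) (hK z y)
  refine tsum_nonneg fun j => ?_
  have := hpow j x y
  positivity

open scoped Matrix.Norms.Operator in
lemma heatKer_eq_exp (K : Matrix V V ℝ) (t : ℝ) :
    Matrix.of (heatKer K t) = NormedSpace.exp (t • (K - 1)) := by
  have hsplit : t • (K - 1) = algebraMap ℝ (Matrix V V ℝ) (-t) + t • K := by
    rw [Algebra.algebraMap_eq_smul_one, smul_sub, neg_smul]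
    abel
  have hexp : NormedSpace.exp (t • (K - 1)) = Real.exp (-t) • NormedSpace.exp (t • K) := by
    have h := NormedSpace.algebraMap_exp_comm (𝕂 := ℝ) (𝔸 := Matrix V V ℝ) (-t)
    rw [hsplit, Matrix.exp_add_of_commute _ _ (Algebra.commute_algebraMap_left _ _),
      Algebra.smul_def (Real.exp (-t)), Real.exp_eq_exp_ℝ]
    exact congrArg (· * NormedSpace.exp (t • K)) h.symm
  ext x y
  have h1 := NormedSpace.exp_series_hasSum_exp' (𝕂 := ℝ) (t • K)
  have h2 := (h1.map (Matrix.entryAddMonoidHom ℝ x y)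
    (by change Continuous fun M : Matrix V V ℝ => M x y; fun_prop)).mul_left (Real.exp (-t))
  rw [hexp, Matrix.of_apply, heatKer, Matrix.smul_apply, smul_eq_mul]
  refine HasSum.tsum_eq ?_
  refine Eq.mp (congrArg (HasSum · _) (funext fun j => ?_)) h2
  simp [smul_pow]
  ring

lemma diagonal_offInd_mul_self (A : Finset V) :
    Matrix.diagonal (offInd A) * Matrix.diagonal (offInd A) = Matrix.diagonal (offInd A) := by
  rw [Matrix.diagonal_mul_diagonal]
  congr 1
  funext x
  by_cases hx : x ∈ A <;> simp [offInd, hx]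

lemma killedMat_eq (K : Matrix V V ℝ) (A : Finset V) :
    killedMat K A = Matrix.diagonal (offInd A) * K * Matrix.diagonal (offInd A) := by
  ext x y
  rw [Matrix.mul_diagonal, Matrix.diagonal_mul]
  by_cases hx : x ∈ A <;> by_cases hy : y ∈ A <;> simp [killedMat, offInd, hx, hy]

open scoped Matrix.Norms.Operator in
lemma tendsto_pow_killed (K : Matrix V V ℝ) (A : Finset V) (t : ℝ) :
    Tendsto (fun m : ℕ => (Matrix.diagonal (offInd A) * Matrix.of (heatKer K (t / m)) *
      Matrix.diagonal (offInd A)) ^ m) atTop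
      (nhds (Matrix.diagonal (offInd A) * NormedSpace.exp (t • (killedMat K A - 1)))) := by
  set D := Matrix.diagonal (offInd A) with hD
  have hDD : D * D = D := diagonal_offInd_mul_self A
  have hQ : killedMat K A = D * K * D := killedMat_eq K A
  have hcomm : Commute D (killedMat K A - 1) := by
    rw [hQ, Commute, SemiconjBy, mul_sub, sub_mul, mul_one, one_mul]
    congr 1
    rw [mul_assoc (D * K), hDD, ← mul_assoc, ← mul_assoc, hDD]
  have hS : HasDerivAt (fun h : ℝ => D * NormedSpace.exp (h • (K - 1)) * D)
      (D * (K - 1) * D) 0 := by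
    have h := hasDerivAt_exp_smul_const (K - 1) (0 : ℝ)
    rw [zero_smul, NormedSpace.exp_zero, one_mul] at h
    exact (h.const_mul D).mul_const D
  have hT : HasDerivAt (fun h : ℝ => D * NormedSpace.exp (h • (killedMat K A - 1)))
      (D * (K - 1) * D) 0 := by
    have h := hasDerivAt_exp_smul_const (killedMat K A - 1) (0 : ℝ)
    rw [zero_smul, NormedSpace.exp_zero, one_mul] at h
    have e : D * (killedMat K A - 1) = D * (K - 1) * D := by
      rw [hQ]
      simp only [mul_sub, sub_mul, mul_one, ← mul_assoc, hDD]
    rw [← e]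
    exact h.const_mul D
  have hnorm : ‖D‖ ≤ 1 := by
    rw [hD, Matrix.linfty_opNorm_diagonal, pi_norm_le_iff_of_nonneg zero_le_one]
    intro x
    by_cases hx : x ∈ A <;> simp [offInd, hx]
  have h := tendsto_pow_sub_pow_of_hasDerivAt hS hT (by simp [hDD]) (by simpa [hDD] using hnorm) t
  have hpow : ∀ m : ℕ, 0 < m → (D * NormedSpace.exp ((t / m) • (killedMat K A - 1))) ^ m =
      D * NormedSpace.exp (t • (killedMat K A - 1)) := by
    intro m hm
    have hc : Commute D (NormedSpace.exp ((t / (m : ℝ)) • (killedMat K A - 1))) :=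
      (hcomm.smul_right _).exp_right
    have hDm : D ^ m = D := (show IsIdempotentElem D from hDD).pow_eq hm.ne'
    rw [hc.mul_pow, ← Matrix.exp_nsmul, hDm, ← Nat.cast_smul_eq_nsmul ℝ, smul_smul,
      mul_div_cancel₀]
    exact_mod_cast hm.ne'
  have h2 := h.add_const (D * NormedSpace.exp (t • (killedMat K A - 1)))
  rw [zero_add] at h2
  refine h2.congr' ?_
  filter_upwards [eventually_gt_atTop 0] with m hm
  rw [hpow m hm, heatKer_eq_exp, sub_add_cancel]

end HeatKernel

namespace CTMC

variable {V : Type} [Fintype V] [DecidableEq V] {K : Matrix V V ℝ}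

instance (W : CTMC V K) : MeasurableSpace W.Ω := W.mΩ

instance (W : CTMC V K) (x : V) : IsProbabilityMeasure (W.P x) := W.prob x

/-- The event that `A` is avoided during `[0, t]`. -/
def avoid (W : CTMC V K) (A : Finset V) (t : ℝ) : Set W.Ω :=
  {ω | ∀ s, 0 ≤ s → s ≤ t → W.X s ω ∉ A}

/-- The event that `A` is avoided at the first `m + 1` multiples of `h`. -/
def gridAvoid (W : CTMC V K) (A : Finset V) (m : ℕ) (h : ℝ) : Set W.Ω :=
  {ω | ∀ i : Fin (m + 1), W.X ((i : ℝ) * h) ω ∉ A}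

lemma measurableSet_mem (W : CTMC V K) (t : ℝ) (A : Finset V) :
    MeasurableSet {ω : W.Ω | W.X t ω ∈ A} := by
  have : {ω : W.Ω | W.X t ω ∈ A} = ⋃ y ∈ A, {ω | W.X t ω = y} := by
    ext ω; simp
  rw [this]
  exact A.measurableSet_biUnion fun y _ => W.measX t y

lemma measurableSet_gridAvoid (W : CTMC V K) (A : Finset V) (m : ℕ) (h : ℝ) :
    MeasurableSet (W.gridAvoid A m h) := by
  rw [gridAvoid, Set.ofPred_forall]
  exact MeasurableSet.iInter fun i => (W.measurableSet_mem _ A).compl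

lemma sum_path_weights (w : V → ℝ) (p : V → V → ℝ) (m : ℕ) (x : V) :
    ∑ y : Fin (m + 1) → V, (∏ i, w (y i)) *
      ((if y 0 = x then (1 : ℝ) else 0) * ∏ i : Fin m, p (y i.castSucc) (y i.succ)) =
      (((Matrix.diagonal w * Matrix.of p) ^ m).mulVec w) x := by
  induction m generalizing x with
  | zero =>
    rw [← (Equiv.funUnique (Fin 1) V).symm.sum_comp]
    simp
  | succ m ih =>
    rw [← (Fin.consEquiv fun _ => V).sum_comp, Fintype.sum_prod_type]
    have e : ∀ z : V, ∑ y : Fin (m + 1) → V, (∏ i, w ((Fin.consEquiv fun _ => V) (z, y) i)) *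
        ((if (Fin.consEquiv fun _ => V) (z, y) 0 = x then (1 : ℝ) else 0) *
          ∏ i : Fin (m + 1), p ((Fin.consEquiv fun _ => V) (z, y) i.castSucc)
            ((Fin.consEquiv fun _ => V) (z, y) i.succ)) =
        if z = x then w x * ∑ y : Fin (m + 1) → V, p x (y 0) * ((∏ i, w (y i)) *
          ∏ i : Fin m, p (y i.castSucc) (y i.succ)) else 0 := by
      intro z
      split_ifs with hz
      · subst hz
        rw [Finset.mul_sum]
        refine Finset.sum_congr rfl fun y _ => ?_
        rw [Fin.prod_univ_succ, Fin.prod_univ_succ (fun i : Fin (m + 1) =>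
          p ((Fin.consEquiv fun _ => V) (z, y) i.castSucc)
            ((Fin.consEquiv fun _ => V) (z, y) i.succ))]
        simp [Fin.consEquiv]
        ring
      · refine Finset.sum_eq_zero fun y _ => ?_
        simp [Fin.consEquiv, hz]
    rw [Finset.sum_congr rfl fun z _ => e z, Finset.sum_ite_eq' Finset.univ x]
    simp only [Finset.mem_univ, if_true]
    rw [pow_succ', ← Matrix.mulVec_mulVec, ← Matrix.mulVec_mulVec, Matrix.mulVec_diagonal]
    congr 1
    simp only [Matrix.mulVec, dotProduct, Matrix.of_apply] at ih ⊢
    simp_rw [← ih, Finset.mul_sum]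
    rw [Finset.sum_comm]
    refine Finset.sum_congr rfl fun y _ => ?_
    rw [Finset.sum_eq_single (y 0)]
    · simp
    · intro b _ hb
      simp [Ne.symm hb]
    · simp

lemma diagonal_mul_pow_mulVec (A : Finset V) (P : Matrix V V ℝ) (m : ℕ) :
    ((Matrix.diagonal (offInd A) * P) ^ m).mulVec (offInd A) =
      ((Matrix.diagonal (offInd A) * P * Matrix.diagonal (offInd A)) ^ m).mulVec (offInd A) := by
  have hD : (Matrix.diagonal (offInd A)).mulVec (offInd A) = offInd A := by
    funext x
    rw [Matrix.mulVec_diagonal]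
    by_cases hx : x ∈ A <;> simp [offInd, hx]
  have hfix : ∀ m, (Matrix.diagonal (offInd A)).mulVec
      (((Matrix.diagonal (offInd A) * P * Matrix.diagonal (offInd A)) ^ m).mulVec (offInd A)) =
      ((Matrix.diagonal (offInd A) * P * Matrix.diagonal (offInd A)) ^ m).mulVec (offInd A) := by
    intro m
    cases m with
    | zero => simpa using hD
    | succ m =>
      rw [Matrix.mulVec_mulVec, pow_succ', ← mul_assoc, ← mul_assoc, ← mul_assoc,
        diagonal_offInd_mul_self]
  induction m with
  | zero => simp
  | succ m ih =>
    rw [pow_succ', ← Matrix.mulVec_mulVec, ih, pow_succ']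
    conv_rhs => rw [← Matrix.mulVec_mulVec, ← Matrix.mulVec_mulVec, hfix]

lemma prx_gridAvoid (W : CTMC V K) (hK : ∀ x y, 0 ≤ K x y) (A : Finset V) (m : ℕ) {h : ℝ}
    (hh : 0 ≤ h) (x : V) :
    (W.P x).real (W.gridAvoid A m h) =
      (((Matrix.diagonal (offInd A) * Matrix.of (heatKer K h) *
        Matrix.diagonal (offInd A)) ^ m).mulVec (offInd A)) x := by
  rw [← diagonal_mul_pow_mulVec, ← sum_path_weights]
  have hunion : W.gridAvoid A m h = ⋃ y ∈ Finset.univ.filter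
      (fun y : Fin (m + 1) → V => ∀ i, y i ∉ A), {ω | ∀ i : Fin (m + 1), W.X (i * h) ω = y i} := by
    ext ω
    simp only [gridAvoid, Set.mem_ofPred_eq, Finset.mem_filter, Finset.mem_univ, true_and,
      Set.mem_iUnion, exists_prop]
    constructor
    · intro hω
      exact ⟨fun i => W.X (i * h) ω, hω, fun i => rfl⟩
    · rintro ⟨y, hy, hω⟩ i
      rw [hω i]
      exact hy i
  rw [hunion, measureReal_biUnion_finset, Finset.sum_filter]
  · refine Finset.sum_congr rfl fun y _ => ?_
    have hval : (W.P x).real {ω | ∀ i : Fin (m + 1), W.X (i * h) ω = y i} =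
        (if y 0 = x then (1 : ℝ) else 0) *
          ∏ i : Fin m, heatKer K h (y i.castSucc) (y i.succ) := by
      have := W.fdd x m (fun i => (i : ℝ) * h) (fun i j hij => by
        have : (i : ℝ) ≤ (j : ℝ) := by exact_mod_cast hij
        exact mul_le_mul_of_nonneg_right this hh) (by simp) y
      have e : ∀ i : Fin m, ((i.succ : Fin (m + 1)) : ℝ) * h - ((i.castSucc : Fin (m + 1)) : ℝ) * h
          = h := by
        intro i
        simp
        ring
      simp only [e] at this
      rw [measureReal_def, this, ENNReal.toReal_ofReal]
      refine mul_nonneg (by split_ifs <;> norm_num) (Finset.prod_nonneg fun i _ => ?_)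
      exact heatKer_nonneg hK hh _ _
    by_cases hy : ∀ i, y i ∉ A
    · have h1 : ∏ i, offInd A (y i) = 1 := Finset.prod_eq_one fun i _ => by simp [offInd, hy i]
      rw [if_pos hy, hval, h1, one_mul]
    · rw [if_neg hy]
      push Not at hy
      obtain ⟨i, hi⟩ := hy
      rw [Finset.prod_eq_zero (Finset.mem_univ i) (by simp [offInd, hi]), zero_mul]
  · intro y _ z _ hyz
    rw [Function.onFun, Set.disjoint_left]
    intro ω h1 h2
    exact hyz (funext fun i => (h1 i).symm.trans (h2 i))
  · intro y _
    rw [Set.ofPred_forall]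
    exact MeasurableSet.iInter fun i => W.measX _ _

lemma avoid_eq_iInter_gridAvoid (W : CTMC V K) (A : Finset V) {t : ℝ} (ht : 0 ≤ t) :
    W.avoid A t = ⋂ l : ℕ, W.gridAvoid A (2 ^ l) (t / (2 ^ l : ℕ)) := by
  ext ω
  simp only [Set.mem_iInter, avoid, gridAvoid, Set.mem_ofPred_eq]
  have hp : ∀ l : ℕ, (0 : ℝ) < (2 ^ l : ℕ) := fun l => by positivity
  constructor
  · intro h l i
    have hi : (i : ℝ) ≤ (2 ^ l : ℕ) := by exact_mod_cast Nat.lt_succ_iff.mp i.2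
    refine h _ (by have := hp l; positivity) ?_
    rw [mul_div_assoc', div_le_iff₀ (hp l), mul_comm]
    exact mul_le_mul_of_nonneg_left hi ht
  · intro h s hs0 hst hmem
    rcases hst.eq_or_lt with rfl | hlt
    · have := h 0 1
      simp [hmem] at this
    · have htpos : 0 < t := hs0.trans_lt hlt
      obtain ⟨ε, hε, hX⟩ := W.rightCts ω s
      obtain ⟨l, hl⟩ := exists_nat_gt (t / ε)
      have hl2 : t / (2 ^ l : ℕ) < ε := by
        have h2 : (l : ℝ) < (2 ^ l : ℕ) := by exact_mod_cast Nat.lt_two_pow_self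
        rw [div_lt_iff₀ (hp l), mul_comm, ← div_lt_iff₀ hε]
        exact hl.trans h2
      have hfl : ⌊s * (2 ^ l : ℕ) / t⌋₊ < 2 ^ l := by
        rw [Nat.floor_lt (by positivity), div_lt_iff₀ htpos, mul_comm]
        exact mul_lt_mul_of_pos_left hlt (hp l)
      have hgrid := h l ⟨⌊s * (2 ^ l : ℕ) / t⌋₊ + 1, by omega⟩
      simp only [Nat.cast_add, Nat.cast_one] at hgrid
      have h1 := Nat.lt_floor_add_one (s * (2 ^ l : ℕ) / t)
      have h2 := Nat.floor_le (show 0 ≤ s * (2 ^ l : ℕ) / t by positivity)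
      rw [div_lt_iff₀ htpos] at h1
      rw [le_div_iff₀ htpos] at h2
      rw [hX] at hgrid
      · exact hgrid hmem
      · rw [mul_div_assoc', le_div_iff₀ (hp l)]
        exact h1.le
      · rw [add_mul, one_mul]
        refine add_lt_add_of_le_of_lt ?_ hl2
        rw [mul_div_assoc', div_le_iff₀ (hp l)]
        exact h2

lemma antitone_gridAvoid (W : CTMC V K) (A : Finset V) (t : ℝ) :
    Antitone fun l : ℕ => W.gridAvoid A (2 ^ l) (t / (2 ^ l : ℕ)) := by
  refine antitone_nat_of_succ_le fun l ω h i => ?_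
  have hi := i.2
  have := h ⟨2 * i, by rw [pow_succ]; omega⟩
  convert this using 3
  push_cast
  field_simp
  ring

lemma measurableSet_avoid (W : CTMC V K) (A : Finset V) {t : ℝ} (ht : 0 ≤ t) :
    MeasurableSet (W.avoid A t) := by
  rw [W.avoid_eq_iInter_gridAvoid A ht]
  exact MeasurableSet.iInter fun l => W.measurableSet_gridAvoid A _ _

lemma prx_avoid (W : CTMC V K) (hK : ∀ x y, 0 ≤ K x y) (A : Finset V) {t : ℝ} (ht : 0 ≤ t)
    (x : V) :
    (W.P x).real (W.avoid A t) = offInd A x *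
      ((NormedSpace.exp (t • (killedMat K A - 1))).mulVec (offInd A)) x := by
  have h1 : Tendsto (fun l : ℕ => (W.P x).real (W.gridAvoid A (2 ^ l) (t / (2 ^ l : ℕ)))) atTop
      (nhds ((W.P x).real (W.avoid A t))) := by
    rw [W.avoid_eq_iInter_gridAvoid A ht]
    exact (ENNReal.tendsto_toReal (measure_ne_top _ _)).comp
      (tendsto_measure_iInter_atTop
        (fun l => (W.measurableSet_gridAvoid A _ _).nullMeasurableSet)
        (W.antitone_gridAvoid A t) ⟨0, measure_ne_top _ _⟩)
  have hcont : Continuous fun M : Matrix V V ℝ => (M.mulVec (offInd A)) x := by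
    fun_prop
  have h2 := (hcont.tendsto _).comp ((tendsto_pow_killed K A t).comp
    (tendsto_pow_atTop_atTop_of_one_lt (r := 2) (by norm_num)))
  have h3 := tendsto_nhds_unique h1 (h2.congr fun l => ?_)
  · rw [h3, ← Matrix.mulVec_mulVec, Matrix.mulVec_diagonal]
  · exact (W.prx_gridAvoid hK A (2 ^ l) (by positivity) x).symm

lemma avg_avoid (W : CTMC V K) (hK : ∀ x y, 0 ≤ K x y) (A : Finset V) {t : ℝ} (ht : 0 ≤ t) :
    (Fintype.card V : ℝ)⁻¹ * ∑ x, (W.P x).real (W.avoid A t) = killedTail K A t := by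
  rw [killedTail]
  congr 1
  exact Finset.sum_congr rfl fun x _ => W.prx_avoid hK A ht x

end CTMC

namespace CTMC

variable {V : Type} [Fintype V] [DecidableEq V] {K : Matrix V V ℝ}

lemma hit_nonneg (W : CTMC V K) (A : Set V) (ω : W.Ω) : 0 ≤ W.hit A ω :=
  Real.sInf_nonneg fun _ ht => ht.1

lemma hit_mem (W : CTMC V K) (A : Set V) (ω : W.Ω) (h : ∃ s, 0 ≤ s ∧ W.X s ω ∈ A) :
    W.X (W.hit A ω) ω ∈ A := by
  obtain ⟨ε, hε, hX⟩ := W.rightCts ω (W.hit A ω)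
  obtain ⟨s, hs, hlt⟩ := exists_lt_of_csInf_lt (s := {t : ℝ | 0 ≤ t ∧ W.X t ω ∈ A}) h
    (show W.hit A ω < W.hit A ω + ε by linarith)
  rw [← hX s (csInf_le ⟨0, fun _ ht => ht.1⟩ hs) hlt]
  exact hs.2

/-- The event that `A` is never hit. -/
def never (W : CTMC V K) (A : Finset V) : Set W.Ω := {ω | ∀ s, 0 ≤ s → W.X s ω ∉ A}

lemma setOf_lt_hit (W : CTMC V K) (A : Finset V) {t : ℝ} (ht : 0 ≤ t) :
    {ω | t < W.hit ↑A ω} = W.avoid A t \ W.never A := by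
  ext ω
  simp only [Set.mem_ofPred_eq, Set.mem_sdiff, avoid, never, not_forall, not_not]
  constructor
  · intro h
    refine ⟨fun s hs0 hst hmem => ?_, ?_⟩
    · have : W.hit ↑A ω ≤ s := csInf_le ⟨0, fun _ ht => ht.1⟩ ⟨hs0, hmem⟩
      linarith
    · by_contra! hne
      have : W.hit ↑A ω = 0 := by
        have e : {t : ℝ | 0 ≤ t ∧ W.X t ω ∈ (A : Set V)} = ∅ :=
          Set.eq_empty_of_forall_notMem fun s hs => hne s hs.1 hs.2
        rw [hit, e, Real.sInf_empty]
      linarith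
  · rintro ⟨h, s, hs0, hs⟩
    by_contra! hle
    exact h _ (W.hit_nonneg _ ω) hle (W.hit_mem A ω ⟨s, hs0, hs⟩)

lemma never_eq_iInter (W : CTMC V K) (A : Finset V) :
    W.never A = ⋂ m : ℕ, W.avoid A m := by
  ext ω
  simp only [never, avoid, Set.mem_iInter, Set.mem_ofPred_eq]
  refine ⟨fun h m s hs _ => h s hs, fun h s hs => ?_⟩
  obtain ⟨m, hm⟩ := exists_nat_ge s
  exact h m s hs hm

lemma measurableSet_never (W : CTMC V K) (A : Finset V) : MeasurableSet (W.never A) := by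
  rw [W.never_eq_iInter]
  exact MeasurableSet.iInter fun m => W.measurableSet_avoid A m.cast_nonneg

lemma measurable_hit (W : CTMC V K) (A : Finset V) : Measurable (W.hit ↑A) := by
  refine measurable_of_Ioi fun t => ?_
  change MeasurableSet {ω | t < W.hit ↑A ω}
  rcases le_or_gt 0 t with ht | ht
  · rw [W.setOf_lt_hit A ht]
    exact (W.measurableSet_avoid A ht).diff (W.measurableSet_never A)
  · have : {ω | t < W.hit ↑A ω} = Set.univ :=
      Set.eq_univ_of_forall fun ω => ht.trans_le (W.hit_nonneg _ ω)
    rw [this]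
    exact MeasurableSet.univ

variable [Nonempty V]

lemma prx_avoid_le (W : CTMC V K) (hK : ∀ x y, 0 ≤ K x y) (A : Finset V) {t : ℝ} (ht : 0 ≤ t)
    (x : V) : (W.P x).real (W.avoid A t) ≤ Fintype.card V * killedTail K A t := by
  have hn : (0 : ℝ) < Fintype.card V := by exact_mod_cast Fintype.card_pos
  rw [← W.avg_avoid hK A ht, mul_inv_cancel_left₀ hn.ne']
  exact Finset.single_le_sum (f := fun x => (W.P x).real (W.avoid A t))
    (fun _ _ => measureReal_nonneg) (Finset.mem_univ x)

lemma prx_never (W : CTMC V K) (hK : ∀ x y, 0 ≤ K x y) (A : Finset V)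
    (hlim : Tendsto (killedTail K A) atTop (nhds 0)) (x : V) : W.P x (W.never A) = 0 := by
  rw [← measureReal_eq_zero_iff]
  refine le_antisymm ?_ measureReal_nonneg
  have h := hlim.const_mul (Fintype.card V : ℝ)
  rw [mul_zero] at h
  refine ge_of_tendsto h ?_
  filter_upwards [eventually_ge_atTop 0] with t ht
  have hsub : W.never A ⊆ W.avoid A t := fun ω hω s hs _ => hω s hs
  exact (measureReal_mono hsub).trans (W.prx_avoid_le hK A ht x)

lemma prx_lt_hit (W : CTMC V K) (hK : ∀ x y, 0 ≤ K x y) (A : Finset V)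
    (hlim : Tendsto (killedTail K A) atTop (nhds 0)) (x : V) {t : ℝ} (ht : 0 ≤ t) :
    (W.P x).real {ω | t < W.hit ↑A ω} = (W.P x).real (W.avoid A t) := by
  rw [W.setOf_lt_hit A ht, measureReal_def, measureReal_def,
    measure_sdiff_null (W.prx_never hK A hlim x)]

lemma prpi_lt_hit (W : CTMC V K) (hK : ∀ x y, 0 ≤ K x y) (A : Finset V)
    (hlim : Tendsto (killedTail K A) atTop (nhds 0)) {t : ℝ} (ht : 0 ≤ t) :
    W.prpi {ω | t < W.hit ↑A ω} = killedTail K A t := by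
  rw [← W.avg_avoid hK A ht, prpi]
  congr 1
  exact Finset.sum_congr rfl fun x _ => W.prx_lt_hit hK A hlim x ht

lemma epi_hit (W : CTMC V K) (hK : ∀ x y, 0 ≤ K x y) (A : Finset V)
    (hlim : Tendsto (killedTail K A) atTop (nhds 0))
    (hinteg : IntegrableOn (killedTail K A) (Set.Ioi 0)) :
    W.epi (W.hit ↑A) = ∫ t in Set.Ioi 0, killedTail K A t := by
  have hle : ∀ x t, 0 ≤ t → (W.P x).real {ω | t < W.hit ↑A ω} ≤
      Fintype.card V * killedTail K A t := fun x t ht =>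
    (W.prx_lt_hit hK A hlim x ht).trans_le (W.prx_avoid_le hK A ht x)
  have hanti : ∀ x, Antitone fun t => (W.P x).real {ω | t < W.hit ↑A ω} := fun x a b hab =>
    measureReal_mono fun ω (hω : b < _) => lt_of_le_of_lt hab hω
  have htail : ∀ x, IntegrableOn (fun t => (W.P x).real {ω | t < W.hit ↑A ω}) (Set.Ioi 0) := by
    intro x
    refine (hinteg.const_mul (Fintype.card V : ℝ)).mono' (hanti x).measurable.aestronglyMeasurable ?_
    refine (ae_restrict_iff' measurableSet_Ioi).2 (Eventually.of_forall fun t ht => ?_)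
    rw [Real.norm_of_nonneg measureReal_nonneg]
    exact hle x t (le_of_lt ht)
  have hhit : ∀ x, Integrable (W.hit ↑A) (W.P x) := by
    intro x
    refine ⟨(W.measurable_hit A).aestronglyMeasurable, ?_⟩
    have hnn : 0 ≤ᵐ[W.P x] W.hit ↑A := Eventually.of_forall (W.hit_nonneg _)
    rw [hasFiniteIntegral_iff_ofReal hnn,
      lintegral_eq_lintegral_meas_lt _ hnn (W.measurable_hit A).aemeasurable]
    have := (htail x).2
    rw [hasFiniteIntegral_iff_ofReal (Eventually.of_forall fun _ => measureReal_nonneg)] at this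
    simpa [ofReal_measureReal] using this
  have hex : ∀ x, W.ex x (W.hit ↑A) = ∫ t in Set.Ioi 0, (W.P x).real {ω | t < W.hit ↑A ω} :=
    fun x => (hhit x).integral_eq_integral_meas_lt (Eventually.of_forall (W.hit_nonneg _))
  rw [epi, Finset.sum_congr rfl fun x _ => hex x, ← integral_finsetSum _ fun x _ => htail x,
    ← integral_const_mul]
  refine setIntegral_congr_fun measurableSet_Ioi fun t ht => ?_
  exact W.prpi_lt_hit hK A hlim (le_of_lt ht)

end CTMC

/-- Union bound for hitting probabilities. -/
lemma CTMC.one_sub_killedTail_le {V : Type} [Fintype V] [DecidableEq V] [Nonempty V]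
    {K : Matrix V V ℝ} (W : CTMC V K) (hK : ∀ x y, 0 ≤ K x y) (A : Finset V) {t : ℝ}
    (ht : 0 ≤ t) : 1 - killedTail K A t ≤ ∑ a ∈ A, (1 - killedTail K {a} t) := by
  have hn : (Fintype.card V : ℝ) ≠ 0 := by exact_mod_cast Fintype.card_ne_zero
  have havg : ∀ A : Finset V, 1 - killedTail K A t =
      (Fintype.card V : ℝ)⁻¹ * ∑ x, (W.P x).real (W.avoid A t)ᶜ := by
    intro A
    rw [← W.avg_avoid hK A ht,
      Finset.sum_congr rfl fun x _ => probReal_compl_eq_one_sub (W.measurableSet_avoid A ht)]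
    rw [Finset.sum_sub_distrib, mul_sub]
    simp [hn]
  simp_rw [havg]
  rw [← Finset.mul_sum, Finset.sum_comm]
  gcongr with x _
  refine (measureReal_mono ?_ (measure_ne_top _ _)).trans (measureReal_biUnion_finset_le A _)
  intro ω hω
  simp only [CTMC.avoid, Set.mem_compl_iff, Set.mem_ofPred_eq, not_forall, not_not] at hω
  obtain ⟨s, hs0, hst, hs⟩ := hω
  simp only [Set.mem_iUnion]
  refine ⟨_, hs, fun h => h s hs0 hst (Finset.mem_singleton_self _)⟩

section Transitive

variable {V : Type} {G : SimpleGraph V}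

lemma IsVertexTransitive.degree_eq [Fintype V] [DecidableRel G.Adj] (hG : IsVertexTransitive G) (x y : V) :
    G.degree x = G.degree y := by
  obtain ⟨φ, rfl⟩ := hG x y
  exact (φ.degree_eq x).symm

lemma transMat_map_iso [Fintype V] [DecidableEq V] [DecidableRel G.Adj] (φ : G ≃g G) (x y : V) : transMat G (φ x) (φ y) = transMat G x y := by
  simp [transMat, φ.degree_eq, φ.map_rel_iff]

lemma transMat_nonneg [Fintype V] [DecidableEq V] [DecidableRel G.Adj] (x y : V) : 0 ≤ transMat G x y := by
  rw [transMat, Matrix.of_apply]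
  split_ifs <;> positivity

lemma IsVertexTransitive.transMat_symm [Fintype V] [DecidableEq V] [DecidableRel G.Adj] (hG : IsVertexTransitive G) (x y : V) :
    transMat G x y = transMat G y x := by
  simp [transMat, G.adj_comm x y, hG.degree_eq x y]

lemma sum_transMat [Fintype V] [DecidableEq V] [DecidableRel G.Adj] {x : V} (hx : 0 < G.degree x) : ∑ y, transMat G x y = 1 := by
  have : (G.degree x : ℝ) ≠ 0 := by exact_mod_cast hx.ne'
  simp only [transMat, Matrix.of_apply]
  rw [← Finset.sum_filter, ← SimpleGraph.neighborFinset_eq_filter, Finset.sum_const,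
    SimpleGraph.card_neighborFinset_eq_degree, nsmul_eq_mul, mul_inv_cancel₀ this]

/-- The Dirichlet form of a symmetric stochastic matrix as a sum of squared gradients. -/
lemma sum_sq_gradient [Fintype V] {K : Matrix V V ℝ} (hs : ∀ x y, K x y = K y x)
    (h1 : ∀ x, ∑ y, K x y = 1) (f : V → ℝ) :
    ∑ x, ∑ y, K x y * (f x - f y) ^ 2 = 2 * ∑ x, f x * (f x - ∑ y, K x y * f y) := by
  have e1 : ∑ x, ∑ y, K x y * f x ^ 2 = ∑ x, f x ^ 2 :=
    Finset.sum_congr rfl fun x _ => by rw [← Finset.sum_mul, h1, one_mul]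
  have e2 : ∑ x, ∑ y, K x y * f y ^ 2 = ∑ x, f x ^ 2 := by
    rw [Finset.sum_comm, ← e1]
    exact Finset.sum_congr rfl fun x _ => Finset.sum_congr rfl fun y _ => by rw [hs]
  have e3 : ∑ x, f x * (f x - ∑ y, K x y * f y) =
      ∑ x, f x ^ 2 - ∑ x, ∑ y, K x y * f x * f y := by
    rw [← Finset.sum_sub_distrib]
    refine Finset.sum_congr rfl fun x _ => ?_
    rw [mul_sub, Finset.mul_sum, sq]
    congr 1
    exact Finset.sum_congr rfl fun y _ => by ring
  calc ∑ x, ∑ y, K x y * (f x - f y) ^ 2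
      = ∑ x, ∑ y, (K x y * f x ^ 2 + K x y * f y ^ 2 - 2 * (K x y * f x * f y)) :=
        Finset.sum_congr rfl fun x _ => Finset.sum_congr rfl fun y _ => by ring
    _ = _ := by
        simp_rw [Finset.sum_sub_distrib, Finset.sum_add_distrib, ← Finset.mul_sum]
        rw [e1, e2, e3]
        ring

lemma sum_sum_sq_sub [Fintype V] (f : V → ℝ) :
    ∑ x, ∑ y, (f x - f y) ^ 2 = 2 * (Fintype.card V * ∑ x, f x ^ 2 - (∑ x, f x) ^ 2) := by
  have : ∀ x y, (f x - f y) ^ 2 = f x ^ 2 + f y ^ 2 - 2 * (f x * f y) := fun x y => by ring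
  simp_rw [this, Finset.sum_sub_distrib, Finset.sum_add_distrib, ← Finset.mul_sum,
    ← Finset.sum_mul, Finset.sum_const, Finset.card_univ, nsmul_eq_mul]
  rw [← Finset.mul_sum]
  ring

lemma IsVertexTransitive.card_mul_sum_iso [Fintype V] (hG : IsVertexTransitive G) [Fintype (G ≃g G)]
    (F : V → ℝ) (u : V) :
    Fintype.card V * ∑ γ : G ≃g G, F (γ u) = Fintype.card (G ≃g G) * ∑ x, F x := by
  have h : ∀ v, ∑ γ : G ≃g G, F (γ v) = ∑ γ : G ≃g G, F (γ u) := by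
    intro v
    obtain ⟨φ, rfl⟩ := hG u v
    exact Equiv.sum_comp (Equiv.mulRight φ) fun γ : G ≃g G => F (γ u)
  calc (Fintype.card V : ℝ) * ∑ γ : G ≃g G, F (γ u)
      = ∑ v, ∑ γ : G ≃g G, F (γ v) := by
        rw [Finset.sum_congr rfl fun v _ => h v, Finset.sum_const, Finset.card_univ, nsmul_eq_mul]
    _ = ∑ γ : G ≃g G, ∑ v, F (γ v) := Finset.sum_comm
    _ = _ := by
        have hγ : ∀ γ : G ≃g G, ∑ v, F (γ v) = ∑ v, F v := fun γ =>
          Equiv.sum_comp (RelIso.toEquiv γ) F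
        simp_rw [hγ, Finset.sum_const, Finset.card_univ, nsmul_eq_mul]

lemma sum_iso_sq_le_of_walk [Fintype (G ≃g G)] (f : V → ℝ) (C : ℝ)
    (hC : ∀ u v, G.Adj u v → ∑ γ : G ≃g G, (f (γ u) - f (γ v)) ^ 2 ≤ C) {x y : V}
    (p : G.Walk x y) : ∑ γ : G ≃g G, (f (γ x) - f (γ y)) ^ 2 ≤ (p.length : ℝ) ^ 2 * C := by
  induction p with
  | nil => simp
  | @cons u v w h p ih =>
    have huv := hC u v h
    rcases Nat.eq_zero_or_pos p.length with h0 | hpos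
    · obtain rfl := SimpleGraph.Walk.eq_of_length_eq_zero h0
      simpa [h0] using huv
    · have hl : (0 : ℝ) < p.length := by exact_mod_cast hpos
      have key : p.length * ∑ γ : G ≃g G, (f (γ u) - f (γ w)) ^ 2 ≤
          p.length * (p.length + 1) * ∑ γ : G ≃g G, (f (γ u) - f (γ v)) ^ 2 +
            (p.length + 1) * ∑ γ : G ≃g G, (f (γ v) - f (γ w)) ^ 2 := by
        simp_rw [Finset.mul_sum, ← Finset.sum_add_distrib]
        refine Finset.sum_le_sum fun γ _ => ?_
        nlinarith [sq_nonneg (p.length * (f (γ u) - f (γ v)) - (f (γ v) - f (γ w)))]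
      have h2 : p.length * (p.length + 1) * ∑ γ : G ≃g G, (f (γ u) - f (γ v)) ^ 2 ≤
          p.length * (p.length + 1) * C := by gcongr
      have h3 : (p.length + 1) * ∑ γ : G ≃g G, (f (γ v) - f (γ w)) ^ 2 ≤
          (p.length + 1) * ((p.length : ℝ) ^ 2 * C) := by gcongr
      rw [SimpleGraph.Walk.length_cons]
      push_cast
      refine le_of_mul_le_mul_left ?_ hl
      nlinarith

/-- A finite connected vertex-transitive graph with more than one vertex satisfies a Poincaré
inequality with constant `d * D ^ 2`, where `d` bounds the degree and `D` is the diameter. -/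
lemma IsVertexTransitive.isPoincareKernel [Fintype V] [DecidableEq V] [DecidableRel G.Adj] (hG : IsVertexTransitive G) (hc : G.Connected)
    [Nontrivial V] {d : ℕ} (hd : ∀ x, G.degree x ≤ d) :
    IsPoincareKernel (transMat G) (d * (gDiam G : ℝ) ^ 2) := by
  have hdeg : ∀ x, 0 < G.degree x := fun x => hc.preconnected.degree_pos_of_nontrivial x
  have hdist : ∀ x y, G.dist x y ≤ gDiam G := fun x y =>
    Finset.le_sup (f := fun p : V × V => G.dist p.1 p.2) (Finset.mem_univ (x, y))
  have hsum : ∀ x, ∑ y, transMat G x y = 1 := fun x => sum_transMat (hdeg x)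
  have hn : (0 : ℝ) < Fintype.card V := by exact_mod_cast Fintype.card_pos
  refine ⟨hG.transMat_symm, transMat_nonneg, hsum, ?_, fun f => ?_⟩
  · obtain ⟨x, y, hxy⟩ := exists_pair_ne V
    have h1 : 1 ≤ gDiam G := (hc.pos_dist_of_ne hxy).trans_le (hdist x y)
    have h2 : 1 ≤ d := (hdeg x).trans_le (hd x)
    exact_mod_cast Nat.mul_pos h2 (pow_pos h1 2)
  · have : Finite (G ≃g G) :=
      Finite.of_injective (fun φ : G ≃g G => (φ : V → V)) DFunLike.coe_injective
    have := Fintype.ofFinite (G ≃g G)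
    have hm : (0 : ℝ) < Fintype.card (G ≃g G) := by exact_mod_cast Fintype.card_pos
    set Q := ∑ x, f x * (f x - ∑ y, transMat G x y * f y) with hQ
    set C := Fintype.card (G ≃g G) * (2 * Q) * d / Fintype.card V with hC
    have hE := sum_sq_gradient hG.transMat_symm hsum f
    have hedge : ∀ u v, G.Adj u v → ∑ γ : G ≃g G, (f (γ u) - f (γ v)) ^ 2 ≤ C := by
      intro u v huv
      have h := hG.card_mul_sum_iso (fun x => ∑ y, transMat G x y * (f x - f y) ^ 2) u
      rw [hE, ← hQ] at h
      rw [hC, ← h, le_div_iff₀ hn, mul_comm, mul_assoc]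
      gcongr
      rw [Finset.sum_mul]
      refine Finset.sum_le_sum fun γ _ => ?_
      have hle : transMat G (γ u) (γ v) * (f (γ u) - f (γ v)) ^ 2 ≤
          ∑ y, transMat G (γ u) y * (f (γ u) - f y) ^ 2 :=
        Finset.single_le_sum (f := fun y => transMat G (γ u) y * (f (γ u) - f y) ^ 2)
          (fun y _ => mul_nonneg (transMat_nonneg _ _) (sq_nonneg _)) (Finset.mem_univ _)
      refine le_trans ?_ (mul_le_mul_of_nonneg_right hle d.cast_nonneg)
      have hu : (0 : ℝ) < G.degree u := by exact_mod_cast hdeg u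
      have hdu : (G.degree u : ℝ) ≤ d := by exact_mod_cast hd u
      rw [transMat_map_iso, transMat, Matrix.of_apply, if_pos huv, mul_right_comm]
      refine le_mul_of_one_le_left (sq_nonneg _) ?_
      rwa [inv_mul_eq_div, one_le_div hu]
    have hC0 : 0 ≤ C := by
      obtain ⟨u⟩ := hc.nonempty
      obtain ⟨v, hv⟩ := (G.degree_pos_iff_exists_adj u).1 (hdeg u)
      exact (Finset.sum_nonneg fun γ _ => sq_nonneg _).trans (hedge u v hv)
    have hpair : ∀ x y, ∑ γ : G ≃g G, (f (γ x) - f (γ y)) ^ 2 ≤ (gDiam G : ℝ) ^ 2 * C := by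
      intro x y
      obtain ⟨p, hp⟩ := hc.exists_walk_length_eq_dist x y
      refine (sum_iso_sq_le_of_walk f C hedge p).trans ?_
      have : (p.length : ℝ) ≤ gDiam G := by exact_mod_cast hp.trans_le (hdist x y)
      gcongr
    have htot : Fintype.card (G ≃g G) * ∑ x, ∑ y, (f x - f y) ^ 2 ≤
        (Fintype.card V : ℝ) ^ 2 * ((gDiam G : ℝ) ^ 2 * C) := by
      calc Fintype.card (G ≃g G) * ∑ x, ∑ y, (f x - f y) ^ 2
          = ∑ γ : G ≃g G, ∑ x, ∑ y, (f (γ x) - f (γ y)) ^ 2 := by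
            rw [← nsmul_eq_mul, ← Finset.card_univ, ← Finset.sum_const]
            refine Finset.sum_congr rfl fun γ _ => ?_
            rw [← Equiv.sum_comp (RelIso.toEquiv γ)]
            exact Finset.sum_congr rfl fun x _ =>
              (Equiv.sum_comp (RelIso.toEquiv γ) fun y => (f (γ x) - f y) ^ 2).symm
        _ = ∑ x, ∑ y, ∑ γ : G ≃g G, (f (γ x) - f (γ y)) ^ 2 := by
            rw [Finset.sum_comm]
            exact Finset.sum_congr rfl fun x _ => Finset.sum_comm
        _ ≤ ∑ _x : V, ∑ _y : V, (gDiam G : ℝ) ^ 2 * C :=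
            Finset.sum_le_sum fun x _ => Finset.sum_le_sum fun y _ => hpair x y
        _ = _ := by
            simp only [Finset.sum_const, Finset.card_univ, nsmul_eq_mul]
            ring
    rw [sum_sum_sq_sub] at htot
    have hfac : (Fintype.card V : ℝ) ^ 2 * ((gDiam G : ℝ) ^ 2 * C) =
        Fintype.card (G ≃g G) * (2 * (Fintype.card V * (d * (gDiam G : ℝ) ^ 2 * Q))) := by
      rw [hC]
      field_simp
    rw [hfac] at htot
    have h2 := le_of_mul_le_mul_left (le_of_mul_le_mul_left htot hm) two_pos
    refine le_of_mul_le_mul_left ?_ hn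
    rw [mul_sub, mul_div_cancel₀ _ hn.ne']
    exact h2

lemma IsVertexTransitive.killedTail_singleton [Fintype V] [DecidableEq V] [DecidableRel G.Adj] (hG : IsVertexTransitive G) (x y : V) (t : ℝ) :
    killedTail (transMat G) {y} t = killedTail (transMat G) {x} t := by
  obtain ⟨φ, rfl⟩ := hG x y
  simpa using killedTail_map (RelIso.toEquiv φ) (fun x y => transMat_map_iso φ x y) {x} t

end Transitive

section Assembly

variable {V : Type} [Fintype V] [DecidableEq V] {K : Matrix V V ℝ} {R : ℝ}

lemma IsPoincareKernel.exists_hit_rate [Nonempty V] (hK : IsPoincareKernel K R) (W : CTMC V K)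
    (A : Finset V) (hA : A.Nonempty) :
    ∃ l : ℝ, 0 < l ∧
      (∀ t, 0 ≤ t → W.prpi {ω | t < W.hit ↑A ω} = killedTail K A t) ∧
      (∀ t, 0 ≤ t → (1 - R * l) * Real.exp (-(l * t)) ≤ killedTail K A t) ∧
      (∀ t, 0 ≤ t → killedTail K A t ≤ Real.exp (-(l * t))) ∧
      l * W.epi (W.hit ↑A) ≤ 1 ∧ 1 - R * l ≤ l * W.epi (W.hit ↑A) ∧
      (1 - A.card / (Fintype.card V : ℝ)) ^ 2 ≤
        W.epi (W.hit ↑A) * (A.card / (Fintype.card V : ℝ)) := by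
  obtain ⟨l, hl, hinteg, hlow, hup, h1, h2, h3⟩ := hK.exists_rate A hA
  have hexp : Tendsto (fun t => Real.exp (-(l * t))) atTop (nhds 0) :=
    Real.tendsto_exp_neg_atTop_nhds_zero.comp (tendsto_id.const_mul_atTop hl)
  have hlowlim : Tendsto (fun t => (1 - R * l) * Real.exp (-(l * t))) atTop (nhds 0) := by
    simpa using hexp.const_mul (1 - R * l)
  have hlim : Tendsto (killedTail K A) atTop (nhds 0) := by
    refine tendsto_of_tendsto_of_tendsto_of_le_of_le' hlowlim hexp ?_ ?_
    · filter_upwards [eventually_ge_atTop 0] with t ht using hlow t ht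
    · filter_upwards [eventually_ge_atTop 0] with t ht using hup t ht
  rw [← W.epi_hit hK.nonneg A hlim hinteg] at h1 h2 h3
  exact ⟨l, hl, fun t ht => W.prpi_lt_hit hK.nonneg A hlim ht, hlow, hup, h1, h2, h3⟩

/-- Comparison of the hitting time of a set with the hitting time of a point, when the hitting
times of points are identically distributed, and the resulting exponential approximation. -/
lemma IsPoincareKernel.prpi_hit_bounds [Nontrivial V] (hK : IsPoincareKernel K R) (W : CTMC V K)
    (o : V) (hhom : ∀ a t, killedTail K {a} t = killedTail K {o} t) (A : Finset V) {k : ℕ}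
    (hk : 1 ≤ k) (hA : A.card = k) (hR : 32 * k * R ≤ Fintype.card V) {L : ℝ} (hL : 0 ≤ L) :
    (1 - 32 * k * R / Fintype.card V) *
        Real.exp (-(W.epi (W.hit {o}) / W.epi (W.hit ↑A)) * L) ≤
      W.prpi {ω | W.epi (W.hit {o}) * L < W.hit ↑A ω} ∧
    W.prpi {ω | W.epi (W.hit {o}) * L < W.hit ↑A ω} ≤
      Real.exp (256 * k ^ 2 * R * L / Fintype.card V) *
        Real.exp (-(W.epi (W.hit {o}) / W.epi (W.hit ↑A)) * L) := by
  have hne : A.Nonempty := Finset.card_pos.1 (by omega)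
  obtain ⟨l₀, hl₀, -, hlow₀, -, hM₀, -, hc⟩ :=
    hK.exists_hit_rate W {o} (Finset.singleton_nonempty o)
  obtain ⟨l, hl, hF, hlow, hup, hM, hM', -⟩ := hK.exists_hit_rate W A hne
  rw [Finset.coe_singleton] at hM₀ hc
  set M₀ := W.epi (W.hit {o})
  set M := W.epi (W.hit ↑A)
  set n : ℝ := (Fintype.card V : ℝ)
  have hn : 2 ≤ n := Nat.ofNat_le_cast.2 Fintype.one_lt_card
  have hk' : (1 : ℝ) ≤ k := by exact_mod_cast hk
  have hR1 := hK.one_le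
  have hM₀n : n ≤ 4 * M₀ := by
    rw [Finset.card_singleton, Nat.cast_one, mul_one_div, le_div_iff₀ (by linarith)] at hc
    have : 1 / n ≤ 1 / 2 := one_div_le_one_div_of_le two_pos hn
    have hsq : 1 / 4 ≤ (1 - 1 / n) ^ 2 := by nlinarith
    have := mul_le_mul_of_nonneg_right hsq (show 0 ≤ n by linarith)
    linarith
  have hM₀pos : 0 < M₀ := by linarith
  have hl₀R : 8 * k * (R * l₀) ≤ 1 := by nlinarith
  have hlk : l ≤ 4 * k * l₀ := by
    set t := (4 * k * l₀)⁻¹ with ht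
    have htpos : 0 < t := by positivity
    have hl₀t : k * (l₀ * t) = 1 / 4 := by
      rw [ht]
      field_simp
    have hunion := W.one_sub_killedTail_le hK.nonneg A htpos.le
    simp_rw [hhom] at hunion
    rw [Finset.sum_const, hA, nsmul_eq_mul] at hunion
    have hexp := Real.one_sub_le_exp_neg (l₀ * t)
    have hRl : 0 ≤ 1 - R * l₀ := by nlinarith
    have h1 : 1 - R * l₀ - l₀ * t ≤ killedTail K {o} t := by
      refine le_trans ?_ (hlow₀ t htpos.le)
      have : 0 ≤ R * l₀ * (l₀ * t) := by positivity
      nlinarith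
    have h2 : 1 / 2 ≤ killedTail K A t := by nlinarith
    have h3 : 1 / 2 ≤ Real.exp (-(l * t)) := h2.trans (hup t htpos.le)
    have h4 : Real.exp (l * t) ≤ 2 := by
      rw [Real.exp_neg, one_div] at h3
      exact (inv_le_inv₀ two_pos (Real.exp_pos _)).1 h3
    have h5 : l * t ≤ 1 := by linarith [Real.add_one_le_exp (l * t)]
    rwa [ht, mul_inv_le_iff₀ (by positivity), one_mul] at h5
  have hRl : R * l ≤ 1 / 2 := by nlinarith
  have hMM₀ : M₀ ≤ 8 * k * M := by
    refine le_of_mul_le_mul_left ?_ hl₀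
    have : 1 / 2 ≤ l * M := by linarith
    have hMnn : 0 ≤ M := nonneg_of_mul_nonneg_right (by linarith) hl
    nlinarith
  have hMpos : 0 < M := pos_of_mul_pos_right (hM₀pos.trans_le hMM₀) (by positivity)
  have hMn : n ≤ 32 * k * M := by linarith
  have hlM : l ≤ 1 / M := (le_div_iff₀ hMpos).2 hM
  have ht : 0 ≤ M₀ * L := by positivity
  have he : -(M₀ / M) * L = -(1 / M * (M₀ * L)) := by ring
  rw [hF _ ht, he]
  constructor
  · refine le_trans ?_ (hlow _ ht)
    have h1 : R * l ≤ 32 * k * R / n := by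
      rw [le_div_iff₀ (by linarith)]
      calc R * l * n ≤ R * l * (32 * k * M) := by gcongr
        _ = 32 * k * R * (l * M) := by ring
        _ ≤ 32 * k * R * 1 := by gcongr
        _ = _ := mul_one _
    gcongr
    linarith
  · refine (hup _ ht).trans ?_
    rw [← Real.exp_add]
    gcongr
    have h1 : 1 / M - l ≤ R / M ^ 2 := by
      have : 1 / M - l = (1 - l * M) / M := by field_simp
      rw [this, sq, ← div_div]
      gcongr
      rw [le_div_iff₀ hMpos]
      nlinarith
    have h2 : R / M ^ 2 * M₀ ≤ 256 * k ^ 2 * R / n := by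
      rw [div_mul_eq_mul_div, div_le_div_iff₀ (by positivity) (by linarith)]
      calc R * M₀ * n ≤ R * (8 * k * M) * (32 * k * M) := by gcongr
        _ = _ := by ring
    have h3 : (1 / M - l) * (M₀ * L) ≤ 256 * k ^ 2 * R * L / n :=
      calc (1 / M - l) * (M₀ * L) ≤ R / M ^ 2 * (M₀ * L) := by gcongr
        _ = R / M ^ 2 * M₀ * L := by ring
        _ ≤ 256 * k ^ 2 * R / n * L := by gcongr
        _ = _ := by ring
    linarith

end Assembly

lemma GoodSeq.tendsto_log {B : ℕ → GW} {d : ℕ} (hB : GoodSeq B d) :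
    Tendsto (fun n => Real.log ((B n).nV)) atTop atTop :=
  Real.tendsto_log_atTop.comp (tendsto_natCast_atTop_atTop.comp hB.2.2.2.1)

lemma GoodSeq.tendsto_sq_diam_div {B : ℕ → GW} {d : ℕ} (hB : GoodSeq B d) :
    Tendsto (fun n => ((B n).D : ℝ) ^ 2 / (B n).nV) atTop (nhds 0) := by
  refine squeeze_zero' (Eventually.of_forall fun n => by positivity) ?_ hB.2.2.2.2
  filter_upwards [hB.tendsto_log.eventually_ge_atTop 1] with n hn
  gcongr
  exact le_mul_of_one_le_right (by positivity) hn

/-- Proposition 2.9: exponential approximation. Uniformly over all sets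
`A` of cardinality `k`, with `t_s = E_π(T_o)(log n + s)`,
`P_π(T_A > t_s) = exp(-(E_π(T_o)/E_π(T_A))(log n + s)) · (1 + o(1))`. -/
theorem exponential_approximation_of_hitting
    (B : ℕ → GW) (d : ℕ) (hB : GoodSeq B d) (k : ℕ) (hk1 : 1 ≤ k) (s : ℝ)
    (o : (n : ℕ) → (B n).V) :
    ∀ ε : ℝ, 0 < ε → ∃ N : ℕ, ∀ n ≥ N, ∀ A : Finset (B n).V, A.card = k →
      |(B n).W.prpi
          {ω | (B n).W.epi ((B n).W.hit {o n}) * (Real.log ((B n).nV) + s) <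
              (B n).W.hit (↑A) ω} -
        Real.exp (-((B n).W.epi ((B n).W.hit {o n}) / (B n).W.epi ((B n).W.hit ↑A)) *
          (Real.log ((B n).nV) + s))|
        ≤ ε * Real.exp (-((B n).W.epi ((B n).W.hit {o n}) / (B n).W.epi ((B n).W.hit ↑A)) *
            (Real.log ((B n).nV) + s)) := by
  intro ε hε
  have h1 : Tendsto (fun n => 32 * k * (d * ((B n).D : ℝ) ^ 2) / (B n).nV) atTop (nhds 0) := by
    have := hB.tendsto_sq_diam_div.const_mul (32 * k * d : ℝ)
    rw [mul_zero] at this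
    refine this.congr fun n => by ring
  have h2 : Tendsto (fun n => Real.exp (256 * (k : ℝ) ^ 2 * (d * ((B n).D : ℝ) ^ 2) *
      (Real.log ((B n).nV) + s) / (B n).nV)) atTop (nhds 1) := by
    have := ((hB.2.2.2.2).add (hB.tendsto_sq_diam_div.const_mul s)).const_mul
      (256 * k ^ 2 * d : ℝ)
    rw [mul_zero, add_zero, mul_zero] at this
    rw [← Real.exp_zero]
    refine (Real.continuous_exp.tendsto 0).comp (this.congr fun n => by ring)
  have hL := hB.tendsto_log.eventually_ge_atTop (-s)
  have hV := hB.2.2.2.1.eventually_ge_atTop 2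
  refine eventually_atTop.1 ?_
  filter_upwards [h1.eventually_le_const hε, h1.eventually_le_const one_pos,
    h2.eventually_le_const (show 1 < 1 + ε by linarith), hL, hV] with n hε1 hle hε2 hs hn A hA
  have hnt : Nontrivial (B n).V := Fintype.one_lt_card_iff_nontrivial.1 hn
  have htr := hB.2.1 n
  have hpos : (0 : ℝ) < (B n).nV := by exact_mod_cast two_pos.trans_le hn
  obtain ⟨hlow, hup⟩ := (htr.isPoincareKernel (hB.1 n) (hB.2.2.1 n)).prpi_hit_bounds (B n).W
    (o n) (fun a t => htr.killedTail_singleton (o n) a t) A hk1 hA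
    ((div_le_one hpos).1 hle) (show 0 ≤ Real.log ((B n).nV) + s by linarith)
  set E := Real.exp (-((B n).W.epi ((B n).W.hit {o n}) / (B n).W.epi ((B n).W.hit ↑A)) *
    (Real.log ((B n).nV) + s))
  have hE : 0 ≤ E := (Real.exp_pos _).le
  have hlow' := (mul_le_mul_of_nonneg_right (sub_le_sub_left hε1 1) hE).trans hlow
  have hup' := hup.trans (mul_le_mul_of_nonneg_right hε2 hE)
  rw [abs_le]
  constructor <;> linarith
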